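/- Identify ℝ¹⁴ with ℍ³ × ℝ² via x = (q₀, q₁, q₂, x₁₃, x₁₄) with q₀, q₁, q₂ quaternions. The Cartan cubic in dimension 14, f₄(x) = x₁₄³ − 3x₁₄x₁₃² + (3/2)x₁₄(|q₀|² + |q₁|² − 2|q₂|²) + (3√3/2)x₁₃(|q₀|² − |q₁|²) + (3√3/2)·((q₀q₁)q₂ + conj(q₂)(conj(q₁)conj(q₀))), satisfies both the eiconal equation |∇f₄(x)|² = 9|x|⁴ for all x ∈ ℝ¹⁴ and the Laplace equation Δf₄ = 0. -/

import Mathlib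

/-- The Cartan isoparametric cubic in dimension 14 (corresponding to `ℍ`, `d = 4`),
under the identification `ℝ¹⁴ ≅ ℍ³ × ℝ²`, `x = (q₀, q₁, q₂, x₁₃, x₁₄)` with
`q_k = (x_{4k+1}, x_{4k+2}, x_{4k+3}, x_{4k+4})`:
`f₄ = x₁₄³ − 3x₁₄x₁₃² + (3/2)x₁₄(|q₀|² + |q₁|² − 2|q₂|²) + (3√3/2)x₁₃(|q₀|² − |q₁|²)
  + (3√3/2)((q₀q₁)q₂ + conj q₂ (conj q₁ conj q₀))`. -/
noncomputable def cartanCubic14 : (Fin 14 → ℝ) → ℝ := fun x =>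
  let q : Fin 3 → Quaternion ℝ := fun k =>
    ⟨x ⟨4 * k.1, by omega⟩, x ⟨4 * k.1 + 1, by omega⟩,
      x ⟨4 * k.1 + 2, by omega⟩, x ⟨4 * k.1 + 3, by omega⟩⟩
  x 13 ^ 3 - 3 * x 13 * x 12 ^ 2 +
    3 / 2 * x 13 *
      (Quaternion.normSq (q 0) + Quaternion.normSq (q 1) - 2 * Quaternion.normSq (q 2)) +
    3 * Real.sqrt 3 / 2 * x 12 * (Quaternion.normSq (q 0) - Quaternion.normSq (q 1)) +
    3 * Real.sqrt 3 / 2 * ((q 0 * q 1) * q 2 + star (q 2) * (star (q 1) * star (q 0))).re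

open MvPolynomial in
/-- The Fréchet derivative of a real polynomial function in a coordinate direction is given by
the formal partial derivative. -/
theorem MvPolynomial.fderiv_eval_single {n : ℕ} (p : MvPolynomial (Fin n) ℝ) (x : Fin n → ℝ)
    (i : Fin n) :
    fderiv ℝ (fun y => eval y p) x (Pi.single i 1) = eval x (pderiv i p) := by
  have hd (q : MvPolynomial (Fin n) ℝ) : Differentiable ℝ fun y : Fin n → ℝ => eval y q := by
    induction q using MvPolynomial.induction_on with
    | C a => simp
    | add p q hp hq => simpa using! hp.fun_add hq
    | mul_X p j hp => simpa using! hp.fun_mul (differentiable_apply j)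
  induction p using MvPolynomial.induction_on with
  | C a => simp
  | add p q hp hq => simp [fderiv_fun_add (hd p x) (hd q x), hp, hq]
  | mul_X p j hp =>
    have hX : fderiv ℝ (fun y : Fin n → ℝ => y j) x = ContinuousLinearMap.proj j :=
      (hasFDerivAt_apply j x).fderiv
    simp only [map_mul, eval_X]
    rw [fderiv_fun_mul (hd p x) (differentiableAt_apply j x)]
    simp [hX, hp, pderiv_X, Pi.single_apply, apply_ite (eval x), eq_comm, mul_comm]

/-- The Cartan cubic in dimension 14 as a polynomial. -/
noncomputable def cartanCubic14Poly : MvPolynomial (Fin 14) ℝ :=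
  let X : Fin 14 → MvPolynomial (Fin 14) ℝ := MvPolynomial.X
  X 13 ^ 3 - MvPolynomial.C 3 * (X 13 * X 12 ^ 2) +
    MvPolynomial.C (3 / 2) * (X 13 *
      (X 0 ^ 2 + X 1 ^ 2 + X 2 ^ 2 + X 3 ^ 2 + X 4 ^ 2 + X 5 ^ 2 + X 6 ^ 2 + X 7 ^ 2 -
        MvPolynomial.C 2 * (X 8 ^ 2 + X 9 ^ 2 + X 10 ^ 2 + X 11 ^ 2))) +
    MvPolynomial.C (3 * Real.sqrt 3 / 2) * (X 12 *
      (X 0 ^ 2 + X 1 ^ 2 + X 2 ^ 2 + X 3 ^ 2 - (X 4 ^ 2 + X 5 ^ 2 + X 6 ^ 2 + X 7 ^ 2))) +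
    MvPolynomial.C (3 * Real.sqrt 3) *
      ((X 0 * X 4 - X 1 * X 5 - X 2 * X 6 - X 3 * X 7) * X 8 -
        (X 0 * X 5 + X 1 * X 4 + X 2 * X 7 - X 3 * X 6) * X 9 -
        (X 0 * X 6 - X 1 * X 7 + X 2 * X 4 + X 3 * X 5) * X 10 -
        (X 0 * X 7 + X 1 * X 6 - X 2 * X 5 + X 3 * X 4) * X 11)

theorem cartanCubic14_eq_eval :
    cartanCubic14 = fun x => MvPolynomial.eval x cartanCubic14Poly := by
  have expand (a b c : Quaternion ℝ) (s t : ℝ) :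
      t ^ 3 - 3 * t * s ^ 2 +
        3 / 2 * t * (Quaternion.normSq a + Quaternion.normSq b - 2 * Quaternion.normSq c) +
        3 * Real.sqrt 3 / 2 * s * (Quaternion.normSq a - Quaternion.normSq b) +
        3 * Real.sqrt 3 / 2 * ((a * b) * c + star c * (star b * star a)).re =
      MvPolynomial.eval ![a.re, a.imI, a.imJ, a.imK, b.re, b.imI, b.imJ, b.imK,
        c.re, c.imI, c.imJ, c.imK, s, t] cartanCubic14Poly := by
    simp [cartanCubic14Poly, Quaternion.normSq_def']
    ring
  funext x
  refine (expand ⟨x 0, x 1, x 2, x 3⟩ ⟨x 4, x 5, x 6, x 7⟩ ⟨x 8, x 9, x 10, x 11⟩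
    (x 12) (x 13)).trans ?_
  congr 2
  ext i
  fin_cases i <;> rfl

theorem MvPolynomial.pderiv_ofNat {σ R : Type*} [CommSemiring R] (i : σ) (n : ℕ) [n.AtLeastTwo] :
    MvPolynomial.pderiv i (ofNat(n) : MvPolynomial σ R) = 0 :=
  (MvPolynomial.pderiv i).map_natCast n

/-- The Cartan cubic in dimension 14 satisfies both the eiconal equation
`|∇f₄|² = 9|x|⁴` and the Laplace equation `Δf₄ = 0`. -/
theorem cartanCubic14_isoparametric :
    (∀ x : Fin 14 → ℝ,
      ∑ i, (fderiv ℝ cartanCubic14 x (Pi.single i 1)) ^ 2 = 9 * (∑ i, x i ^ 2) ^ 2) ∧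
    (∀ x : Fin 14 → ℝ,
      ∑ i, fderiv ℝ (fun y => fderiv ℝ cartanCubic14 y (Pi.single i 1)) x
        (Pi.single i 1) = 0) := by
  have hs : Real.sqrt 3 ^ 2 = 3 := Real.sq_sqrt (by norm_num)
  simp only [cartanCubic14_eq_eval, MvPolynomial.fderiv_eval_single, Fin.sum_univ_ofNat]
  refine ⟨fun x => ?_, fun x => ?_⟩
  · set_option maxRecDepth 4000 in
    simp [cartanCubic14Poly, MvPolynomial.pderiv_X]
    generalize Real.sqrt 3 = s at hs ⊢
    ring_nf
    simp only [hs]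
    ring_nf
  · simp [cartanCubic14Poly, MvPolynomial.pderiv_X, MvPolynomial.pderiv_ofNat]
    ring_nf
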